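/- arXiv:1912.11814 — 2 statements merged into one kernel-verified Lean document; each statement's English description precedes it below -/
import Mathlib

section
/- Suppose H takes integer values on all subsets of V, and let α_low = ⌈ Σ_{i ∈ V} (H(V) − H({i}))/(|V| − 1) ⌉. If no subset X ⊆ V with 2 ≤ |X| and X ≠ V satisfies f_{α_low}(X) = f̂_{α_low}(X), then R_NCO(V) = α_low, and moreover no subset X ⊆ V with 2 ≤ |X| and X ≠ V satisfies H(V) − H(X) + R_NCO(X) ≤ R_NCO(V) (i.e., there is no complimentary subset in the non-asymptotic model). -/
open Finset

variable {ι : Type*} [DecidableEq ι]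

/-- `P` is a partition of the finite set `X`: its blocks are nonempty,
pairwise disjoint, and their union is `X`. -/
def IsPartition (X : Finset ι) (P : Finset (Finset ι)) : Prop :=
  (∀ C ∈ P, C.Nonempty) ∧
  (∀ C ∈ P, ∀ D ∈ P, C ≠ D → Disjoint C D) ∧
  P.sup id = X

/-- The residual entropy function `f_α(X) = α - H(V) + H(X)`. -/
noncomputable def fRes (H : Finset ι → ℝ) (V : Finset ι) (α : ℝ) (X : Finset ι) : ℝ :=
  α - H V + H X

/-- The Dilworth truncation `f̂_α(X) = min_{P ∈ Π(X)} Σ_{C ∈ P} f_α(C)`. -/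
noncomputable def dilworth (H : Finset ι → ℝ) (V : Finset ι) (α : ℝ) (X : Finset ι) : ℝ :=
  sInf { s : ℝ | ∃ P : Finset (Finset ι), IsPartition X P ∧ s = ∑ C ∈ P, fRes H V α C }

/-- The minimum sum-rate for the asymptotic model:
`R_ACO(X) = max_{P ∈ Π(X), |P| ≥ 2} Σ_{C ∈ P} (H(X) - H(C))/(|P| - 1)`. -/
noncomputable def RACO (H : Finset ι → ℝ) (X : Finset ι) : ℝ :=
  sSup { s : ℝ | ∃ P : Finset (Finset ι), IsPartition X P ∧ 2 ≤ P.card ∧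
    s = ∑ C ∈ P, (H X - H C) / ((P.card : ℝ) - 1) }

/-- The minimum sum-rate for the non-asymptotic model: `R_NCO(X) = ⌈R_ACO(X)⌉`. -/
noncomputable def RNCO (H : Finset ι → ℝ) (X : Finset ι) : ℝ :=
  (⌈RACO H X⌉ : ℝ)


theorem aux_sum {X : Finset ι} {P : Finset (Finset ι)} (hP : IsPartition X P) (g : ι → ℝ) :
    ∑ C ∈ P, ∑ i ∈ C, g i = ∑ i ∈ X, g i := by
  obtain ⟨-, h2, h3⟩ := hP
  have : X = P.biUnion id := by rw [← h3, Finset.sup_eq_biUnion]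
  rw [this, Finset.sum_biUnion]
  · rfl
  · intro C hC D hD hne
    exact h2 C hC D hD hne

theorem aux_sub {X : Finset ι} {P : Finset (Finset ι)} (hP : IsPartition X P) {C : Finset ι}
    (hC : C ∈ P) : C ⊆ X := by
  have := Finset.le_sup (f := id) hC
  rw [hP.2.2] at this
  exact this

theorem aux_top {X : Finset ι} {P : Finset (Finset ι)} (hP : IsPartition X P) (hX : X ∈ P) :
    P = {X} := by
  refine Finset.eq_singleton_iff_unique_mem.2 ⟨hX, fun D hD => ?_⟩
  by_contra hne
  have hd := hP.2.1 D hD X hX hne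
  have hs := aux_sub hP hD
  obtain ⟨x, hx⟩ := hP.1 D hD
  exact Finset.disjoint_left.1 hd hx (hs hx)

theorem aux_trivial {X : Finset ι} (hX : X.Nonempty) : IsPartition X {X} := by
  refine ⟨by simpa using hX, ?_, by simp⟩
  intro C hC D hD hne
  simp only [Finset.mem_singleton] at hC hD
  exact absurd (hC.trans hD.symm) hne

theorem aux_single (X : Finset ι) : IsPartition X (X.image fun i => ({i} : Finset ι)) := by
  refine ⟨by simp, ?_, ?_⟩
  · intro C hC D hD hne
    simp only [Finset.mem_image] at hC hD
    obtain ⟨a, -, rfl⟩ := hC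
    obtain ⟨b, -, rfl⟩ := hD
    rw [Finset.disjoint_singleton]
    rintro rfl
    exact hne rfl
  · ext a
    simp [Finset.mem_sup]

theorem aux_card (X : Finset ι) : (X.image fun i => ({i} : Finset ι)).card = X.card :=
  Finset.card_image_of_injective _ Finset.singleton_injective

theorem aux_sum_single (X : Finset ι) (g : Finset ι → ℝ) :
    ∑ C ∈ X.image (fun i => ({i} : Finset ι)), g C = ∑ i ∈ X, g {i} :=
  Finset.sum_image fun _ _ _ _ hab => Finset.singleton_injective hab

theorem aux_bdd (H : Finset ι → ℝ) (X : Finset ι) :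
    BddAbove { s : ℝ | ∃ P : Finset (Finset ι), IsPartition X P ∧ 2 ≤ P.card ∧
    s = ∑ C ∈ P, (H X - H C) / ((P.card : ℝ) - 1) } := by
  apply Set.Finite.bddAbove
  refine Set.Finite.subset (Set.Finite.image
    (fun P : Finset (Finset ι) => ∑ C ∈ P, (H X - H C) / ((P.card : ℝ) - 1))
    (Finset.finite_toSet X.powerset.powerset)) ?_
  rintro s ⟨P, hP, -, rfl⟩
  refine ⟨P, ?_, rfl⟩
  simp only [Finset.coe_powerset, Set.mem_preimage, Set.mem_powerset_iff, Finset.mem_coe]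
  intro C hC
  simpa using aux_sub hP hC

theorem aux_le_RACO (H : Finset ι → ℝ) (X : Finset ι) (hX : 2 ≤ X.card) :
    ∑ i ∈ X, (H X - H {i}) / ((X.card : ℝ) - 1) ≤ RACO H X := by
  apply le_csSup (aux_bdd H X)
  refine ⟨_, aux_single X, by rwa [aux_card], ?_⟩
  rw [aux_card, aux_sum_single X (fun C => (H X - H C) / ((X.card : ℝ) - 1))]

theorem aux_lt {V : Finset ι} {H : Finset ι → ℝ} {α : ℝ}
    (h : ∀ X : Finset ι, X ⊆ V → 2 ≤ X.card → X ≠ V → fRes H V α X ≠ dilworth H V α X)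
    (n : ℕ) : ∀ X : Finset ι, X.card = n → X ⊆ V → 2 ≤ X.card → X ≠ V →
      ∑ i ∈ X, fRes H V α {i} < fRes H V α X := by
  induction n using Nat.strong_induction_on with
  | _ n ih =>
    intro X hn hXV hX hne
    have hXne : X.Nonempty := Finset.card_pos.1 (by omega)
    have : ∃ P, IsPartition X P ∧ ∑ C ∈ P, fRes H V α C < fRes H V α X := by
      by_contra! hcon
      apply h X hXV hX hne
      symm
      apply IsLeast.csInf_eq
      refine ⟨⟨{X}, aux_trivial hXne, by simp⟩, ?_⟩
      rintro s ⟨P, hP, rfl⟩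
      exact hcon P hP
    obtain ⟨P, hP, hlt⟩ := this
    refine lt_of_le_of_lt ?_ hlt
    rw [← aux_sum hP (fun i => fRes H V α {i})]
    apply Finset.sum_le_sum
    intro C hC
    have hCX : C ≠ X := by
      rintro rfl
      rw [aux_top hP hC] at hlt
      simp at hlt
    have hss := aux_sub hP hC
    have hcard := Finset.card_lt_card (hss.ssubset_of_ne hCX)
    have hpos := Finset.card_pos.2 (hP.1 C hC)
    by_cases h1 : C.card = 1
    · obtain ⟨a, rfl⟩ := Finset.card_eq_one.1 h1
      simp
    · refine (ih C.card (by omega) C rfl (hss.trans hXV) (by omega) ?_).le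
      rintro rfl
      exact hCX (hss.antisymm hXV)

theorem no_complimentary_subset_nonasymptotic
    (V : Finset ι) (hV : 2 ≤ V.card) (H : Finset ι → ℝ)
    (hHint : ∀ X ⊆ V, ∃ z : ℤ, H X = z)
    (αlow : ℝ) (hαlow : αlow = (⌈∑ i ∈ V, (H V - H {i}) / ((V.card : ℝ) - 1)⌉ : ℝ))
    (h : ∀ X : Finset ι, X ⊆ V → 2 ≤ X.card → X ≠ V →
      fRes H V αlow X ≠ dilworth H V αlow X) :
    RNCO H V = αlow ∧
      ∀ X : Finset ι, X ⊆ V → 2 ≤ X.card → X ≠ V →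
        ¬ (H V - H X + RNCO H X ≤ RNCO H V) := by
  have hc1 : (0 : ℝ) < (V.card : ℝ) - 1 := by
    have : (2 : ℝ) ≤ V.card := by exact_mod_cast hV
    linarith
  have hlt := fun X hXV hX hne => aux_lt h _ X rfl hXV hX hne
  have hsing : αlow ≤ ∑ i ∈ V, fRes H V αlow {i} := by
    have h1 : ∑ i ∈ V, (H V - H {i}) / ((V.card : ℝ) - 1) ≤ αlow := by
      rw [hαlow]; exact Int.le_ceil _
    rw [← Finset.sum_div, div_le_iff₀ hc1] at h1
    simp only [fRes, Finset.sum_add_distrib, Finset.sum_sub_distrib, Finset.sum_const,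
      nsmul_eq_mul] at h1 ⊢
    linarith
  have hR : RNCO H V = αlow := by
    have hup : RACO H V ≤ αlow := by
      apply csSup_le
      · exact ⟨_, _, aux_single V, by rwa [aux_card], rfl⟩
      rintro s ⟨P, hP, hP2, rfl⟩
      have hp1 : (0 : ℝ) < (P.card : ℝ) - 1 := by
        have : (2 : ℝ) ≤ P.card := by exact_mod_cast hP2
        linarith
      have h2 : ∑ i ∈ V, fRes H V αlow {i} ≤ ∑ C ∈ P, fRes H V αlow C := by
        rw [← aux_sum hP (fun i => fRes H V αlow {i})]
        apply Finset.sum_le_sum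
        intro C hC
        have hpos := Finset.card_pos.2 (hP.1 C hC)
        by_cases h1 : C.card = 1
        · obtain ⟨a, rfl⟩ := Finset.card_eq_one.1 h1
          simp
        · refine (hlt C (aux_sub hP hC) (by omega) ?_).le
          rintro rfl
          rw [aux_top hP hC] at hP2
          simp at hP2
      have h3 := hsing.trans h2
      rw [← Finset.sum_div, div_le_iff₀ hp1]
      simp only [fRes, Finset.sum_add_distrib, Finset.sum_sub_distrib, Finset.sum_const,
        nsmul_eq_mul] at h3 ⊢
      linarith
    apply le_antisymm
    · rw [RNCO, hαlow]
      rw [hαlow] at hup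
      exact_mod_cast Int.ceil_le.2 hup
    · rw [RNCO, hαlow]
      exact_mod_cast Int.ceil_mono (aux_le_RACO H V hV)
  refine ⟨hR, ?_⟩
  intro X hXV hX hne hle
  rw [hR] at hle
  have hx1 : (0 : ℝ) < (X.card : ℝ) - 1 := by
    have : (2 : ℝ) ≤ X.card := by exact_mod_cast hX
    linarith
  have h1 : ∑ i ∈ X, (H X - H {i}) / ((X.card : ℝ) - 1) ≤ αlow - H V + H X := by
    have h2 := aux_le_RACO H X hX
    have h3 : RACO H X ≤ RNCO H X := Int.le_ceil _
    linarith
  have h4 := hlt X hXV hX hne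
  rw [← Finset.sum_div, div_le_iff₀ hx1] at h1
  simp only [fRes, Finset.sum_add_distrib, Finset.sum_sub_distrib, Finset.sum_const,
    nsmul_eq_mul] at h1 h4
  linarith
end

section
/- Suppose H takes integer values on all subsets of V, and let X ⊆ V with 2 ≤ |X|. Then the least integer α satisfying f_α(X) = f̂_α(X) exists and equals H(V) − H(X) + R_NCO(X). -/
open Finset

variable {ι : Type*} [DecidableEq ι]

lemma part_finite (X : Finset ι) : {P : Finset (Finset ι) | IsPartition X P}.Finite := by
  apply Set.Finite.subset (X.powerset.powerset).finite_toSet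
  intro P hP
  simp only [Finset.coe_powerset, Set.mem_preimage, Set.mem_powerset_iff, Finset.coe_subset]
  intro C hC
  have : C ≤ P.sup id := Finset.le_sup (f := id) hC
  rw [hP.2.2] at this
  simpa using this

lemma part_top (X : Finset ι) (hX : X.Nonempty) : IsPartition X {X} := by
  refine ⟨by simpa using hX, ?_, by simp⟩
  intro C hC D hD h
  simp only [Finset.mem_singleton] at hC hD
  exact absurd (hC.trans hD.symm) h

lemma part_bot (X : Finset ι) :
    IsPartition X (X.image fun i => {i}) := by
  refine ⟨by simp, ?_, ?_⟩
  · intro C hC D hD h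
    simp only [Finset.mem_image] at hC hD
    obtain ⟨i, -, rfl⟩ := hC
    obtain ⟨j, -, rfl⟩ := hD
    rw [Finset.disjoint_singleton]
    rintro rfl
    exact h rfl
  · ext a
    simp [Finset.mem_sup]

lemma key (V : Finset ι) (H : Finset ι → ℝ) (X : Finset ι) (hX2 : 2 ≤ X.card) (a : ℝ) :
    fRes H V a X = dilworth H V a X ↔ RACO H X ≤ a - H V + H X := by
  have hXn : X.Nonempty := Finset.card_pos.mp (by omega)
  have hfin1 : {s : ℝ | ∃ P : Finset (Finset ι), IsPartition X P ∧
      s = ∑ C ∈ P, fRes H V a C}.Finite := by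
    apply ((part_finite X).image (fun P => ∑ C ∈ P, fRes H V a C)).subset
    rintro s ⟨P, hP, rfl⟩
    exact ⟨P, hP, rfl⟩
  have hfin2 : {s : ℝ | ∃ P : Finset (Finset ι), IsPartition X P ∧ 2 ≤ P.card ∧
      s = ∑ C ∈ P, (H X - H C) / ((P.card : ℝ) - 1)}.Finite := by
    apply ((part_finite X).image
      (fun P => ∑ C ∈ P, (H X - H C) / ((P.card : ℝ) - 1))).subset
    rintro s ⟨P, hP, -, rfl⟩
    exact ⟨P, hP, rfl⟩
  have hmem : fRes H V a X ∈ {s : ℝ | ∃ P : Finset (Finset ι), IsPartition X P ∧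
      s = ∑ C ∈ P, fRes H V a C} := ⟨{X}, part_top X hXn, by simp⟩
  have arith : ∀ P : Finset (Finset ι), 2 ≤ P.card →
      (fRes H V a X ≤ ∑ C ∈ P, fRes H V a C ↔
        ∑ C ∈ P, (H X - H C) / ((P.card : ℝ) - 1) ≤ a - H V + H X) := by
    intro P hP
    have h2 : (2 : ℝ) ≤ P.card := by exact_mod_cast hP
    rw [← Finset.sum_div, div_le_iff₀ (by linarith)]
    simp only [fRes, Finset.sum_add_distrib, Finset.sum_sub_distrib, Finset.sum_const,
      nsmul_eq_mul]
    constructor <;> intro h <;> nlinarith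
  constructor
  · intro h
    apply csSup_le
    · exact ⟨_, _, part_bot X, by
        rw [Finset.card_image_of_injective _ Finset.singleton_injective]; exact hX2, rfl⟩
    · rintro s ⟨P, hP, hc, rfl⟩
      rw [← arith P hc, h]
      exact csInf_le hfin1.bddBelow ⟨P, hP, rfl⟩
  · intro h
    apply le_antisymm
    · apply le_csInf ⟨_, hmem⟩
      rintro s ⟨P, hP, rfl⟩
      by_cases hc : 2 ≤ P.card
      · rw [arith P hc]
        exact (le_csSup hfin2.bddAbove ⟨P, hP, hc, rfl⟩).trans h
      · have : P.card = 0 ∨ P.card = 1 := by omega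
        rcases this with h0 | h1
        · have := hP.2.2
          rw [Finset.card_eq_zero.mp h0] at this
          simp at this
          exact absurd this.symm hXn.ne_empty
        · obtain ⟨C, rfl⟩ := Finset.card_eq_one.mp h1
          have := hP.2.2
          simp at this
          simp [this]
    · exact csInf_le hfin1.bddBelow hmem

theorem least_integer_alpha_dilworth_tight
    (V : Finset ι) (hV : 2 ≤ V.card) (H : Finset ι → ℝ)
    (hHint : ∀ X ⊆ V, ∃ z : ℤ, H X = z)
    (X : Finset ι) (hXV : X ⊆ V) (hX2 : 2 ≤ X.card) :
    IsLeast { a : ℝ | (∃ z : ℤ, a = (z : ℝ)) ∧ fRes H V a X = dilworth H V a X }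
      (H V - H X + RNCO H X) := by
  obtain ⟨v, hv⟩ := hHint V subset_rfl
  obtain ⟨x, hx⟩ := hHint X hXV
  constructor
  · refine ⟨⟨v - x + ⌈RACO H X⌉, by rw [hv, hx, RNCO]; push_cast; ring⟩, ?_⟩
    rw [key V H X hX2, RNCO]
    linarith [Int.le_ceil (RACO H X)]
  · rintro a ⟨⟨z, rfl⟩, h⟩
    rw [key V H X hX2, hv, hx] at h
    have h3 : ⌈RACO H X⌉ ≤ z - v + x := by
      apply Int.ceil_le.mpr
      push_cast
      exact h
    have h4 : (⌈RACO H X⌉ : ℝ) ≤ z - v + x := by exact_mod_cast h3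
    rw [hv, hx, RNCO]
    linarith
end
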